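/- arXiv:1101.4700 — 2 statements merged into one kernel-verified Lean document; each statement's English description precedes it below -/
import Mathlib

section
/- There exists a universal constant c > 0 with the following property. Let V : ℤ → ℝ be a potential periodic of period q ≥ 1, let Φ_q(E) = T_q(E)···T_1(E) be the q-step transfer matrix with T_n(E) = [[E − V(n), −1],[1,0]], and let Δ(E) = tr Φ_q(E) be the discriminant, so that the essential spectrum of the associated Schrödinger operator is S = {E ∈ ℝ : |Δ(E)| ≤ 2}. Then for every E₀ ∈ ℝ with E₀ ∉ S, |Δ(E₀)| ≥ exp[ c·q·min(dist(E₀, S), 1) ]. -/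
open MeasureTheory Filter Matrix

noncomputable def transferV (V : ℤ → ℝ) (E : ℝ) (n : ℤ) : Matrix (Fin 2) (Fin 2) ℝ :=
  !![E - V n, -1; 1, 0]

noncomputable def cocycleV (V : ℤ → ℝ) (E : ℝ) : ℕ → Matrix (Fin 2) (Fin 2) ℝ
  | 0 => 1
  | n + 1 => transferV V E (n + 1) * cocycleV V E n

/-- The discriminant of a `q`-periodic discrete Schrödinger operator. -/
noncomputable def discrV (V : ℤ → ℝ) (q : ℕ) (E : ℝ) : ℝ :=
  (cocycleV V E q).trace

/-- The essential spectrum of a `q`-periodic discrete Schrödinger operator: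
the preimage of `[-2,2]` under the discriminant. -/
def specV (V : ℤ → ℝ) (q : ℕ) : Set ℝ :=
  {E : ℝ | |discrV V q E| ≤ 2}


lemma approx_eig {F : Type*} [NormedAddCommGroup F] [InnerProductSpace ℝ F]
    [FiniteDimensional ℝ F] (A : F →ₗ[ℝ] F) (hA : A.IsSymmetric) (e ε : ℝ) (hε : 0 ≤ ε)
    (x : F) (hx : x ≠ 0) (h : ‖A x - e • x‖ ≤ ε * ‖x‖) :
    ∃ μ : ℝ, |μ - e| ≤ ε ∧ ∃ f : F, f ≠ 0 ∧ A f = μ • f := by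
  classical
  by_contra hcon
  push Not at hcon
  let b := hA.eigenvectorBasis (n := Module.finrank ℝ F) rfl
  let l := hA.eigenvalues (n := Module.finrank ℝ F) rfl
  have hb : ∀ i, A (b i) = l i • b i := fun i => hA.apply_eigenvectorBasis rfl i
  have hb0 : ∀ i, b i ≠ 0 := fun i => b.orthonormal.ne_zero i
  have hl : ∀ i, ε < |l i - e| := by
    intro i
    by_contra hle
    exact hcon (l i) (not_lt.mp hle) (b i) (hb0 i) (hb i)
  have hin : ∀ i, inner ℝ (b i) (A x - e • x) = (l i - e) * inner ℝ (b i) x := by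
    intro i
    rw [inner_sub_right, ← hA, hb, inner_smul_left, inner_smul_right]
    simp; ring
  have h1 := b.sum_sq_norm_inner_right x
  have h2 := b.sum_sq_norm_inner_right (A x - e • x)
  have hex : ∃ i, inner ℝ (b i) x ≠ 0 := by
    by_contra hall
    push Not at hall
    apply hx
    have : ‖x‖ ^ 2 = 0 := by rw [← h1]; simp [hall]
    simpa using this
  obtain ⟨i0, hi0⟩ := hex
  have h3 : ε ^ 2 * ‖x‖ ^ 2 < ‖A x - e • x‖ ^ 2 := by
    rw [← h1, ← h2, Finset.mul_sum]
    have key : ∀ i, ε ^ 2 < (l i - e) ^ 2 := fun i => by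
      rw [← sq_abs (l i - e)]; exact pow_lt_pow_left₀ (hl i) hε (by norm_num)
    apply Finset.sum_lt_sum
    · intro i _
      rw [hin, norm_mul, mul_pow, Real.norm_eq_abs (l i - e), sq_abs]
      exact mul_le_mul_of_nonneg_right (key i).le (by positivity)
    · refine ⟨i0, Finset.mem_univ _, ?_⟩
      rw [hin, norm_mul, mul_pow, Real.norm_eq_abs (l i0 - e), sq_abs]
      exact mul_lt_mul_of_pos_right (key i0) (by positivity)
  have h4 : ‖A x - e • x‖ ^ 2 ≤ (ε * ‖x‖) ^ 2 := pow_le_pow_left₀ (norm_nonneg _) h 2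
  nlinarith

lemma cocycleV_add (V : ℤ → ℝ) (q : ℕ) (hV : ∀ n : ℤ, V (n + q) = V n) (E : ℝ) (n : ℕ) :
    cocycleV V E (n + q) = cocycleV V E n * cocycleV V E q := by
  induction n with
  | zero => simp [cocycleV]
  | succ n ih =>
    have : n + 1 + q = (n + q) + 1 := by ring
    rw [this, cocycleV, cocycleV, ih, Matrix.mul_assoc]
    congr 1
    unfold transferV
    have := hV (n + 1)
    have h2 : (((n + q : ℕ) : ℤ) + 1) = (n : ℤ) + 1 + q := by push_cast; ring
    rw [h2, this]

lemma cocycleV_det (V : ℤ → ℝ) (E : ℝ) (n : ℕ) : (cocycleV V E n).det = 1 := by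
  induction n with
  | zero => simp [cocycleV]
  | succ n ih => rw [cocycleV, Matrix.det_mul, ih]; simp [transferV, Matrix.det_fin_two]

lemma det_sub_smul (M : Matrix (Fin 2) (Fin 2) ℝ) (h : M.det = 1) (l : ℝ) :
    (M - l • (1 : Matrix (Fin 2) (Fin 2) ℝ)).det = l ^ 2 - l * M.trace + 1 := by
  rw [Matrix.det_fin_two] at *
  simp [Matrix.trace_fin_two]
  linear_combination h

/-- Periodic eigenfunction gives a point of the spectrum. -/
lemma mem_spec (V : ℤ → ℝ) (q : ℕ) (hV : ∀ n : ℤ, V (n + q) = V n) (E : ℝ)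
    (f : ℕ → ℝ) (hf : ∀ n, f (n + 2 * q) = f n)
    (hrec : ∀ n : ℕ, f (n + 2) + f n + V (n + 1) * f (n + 1) = E * f (n + 1))
    (hne : ∃ n, f n ≠ 0) : E ∈ specV V q := by
  have hw : ∀ n, ![f (n + 1), f n] = cocycleV V E n *ᵥ ![f 1, f 0] := by
    intro n
    induction n with
    | zero => simp [cocycleV]
    | succ n ih =>
      rw [cocycleV, ← Matrix.mulVec_mulVec, ← ih]
      ext i
      fin_cases i
      · simp [transferV]; linear_combination hrec n
      · simp [transferV]
  have h0 : ![f 1, f 0] ≠ 0 := by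
    intro h0
    obtain ⟨n, hn⟩ := hne
    apply hn
    have := congrFun (hw n) 1
    rw [h0] at this
    simpa using this
  set M := cocycleV V E q with hM
  have hd : M.det = 1 := cocycleV_det V E q
  have hMM : cocycleV V E (2 * q) = M * M := by
    rw [two_mul, cocycleV_add V q hV]
  have h1 : (M * M) *ᵥ ![f 1, f 0] = ![f 1, f 0] := by
    rw [← hMM, ← hw]
    have a := hf 0
    have b := hf 1
    rw [zero_add] at a
    rw [add_comm] at b
    rw [a, b]
  have hdet : (M * M - 1).det = 0 := by
    apply Matrix.exists_mulVec_eq_zero_iff.mp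
    refine ⟨_, h0, ?_⟩
    rw [Matrix.sub_mulVec, h1]; simp
  have hfac : M * M - 1 = (M - (1 : ℝ) • (1 : Matrix (Fin 2) (Fin 2) ℝ))
      * (M - (-1 : ℝ) • (1 : Matrix (Fin 2) (Fin 2) ℝ)) := by
    simp only [one_smul, neg_smul, sub_neg_eq_add]
    noncomm_ring
  rw [hfac, Matrix.det_mul, det_sub_smul M hd, det_sub_smul M hd] at hdet
  change |M.trace| ≤ 2
  rcases mul_eq_zero.mp hdet with h | h
  · have : M.trace = 2 := by linarith
    rw [this]; norm_num
  · have : M.trace = -2 := by linarith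
    rw [this]; norm_num

/-- Multiplication operator. -/
noncomputable def diagOp {N : ℕ} [NeZero N] (W : ZMod N → ℝ) :
    EuclideanSpace ℝ (ZMod N) →ₗ[ℝ] EuclideanSpace ℝ (ZMod N) where
  toFun x := WithLp.toLp 2 (fun i => W i * x i)
  map_add' x y := by ext i; simp; ring
  map_smul' c x := by ext i; simp; ring

noncomputable def shiftOp (N : ℕ) [NeZero N] :
    EuclideanSpace ℝ (ZMod N) ≃ₗᵢ[ℝ] EuclideanSpace ℝ (ZMod N) :=
  LinearIsometryEquiv.piLpCongrLeft 2 ℝ ℝ (Equiv.subRight (1 : ZMod N))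

lemma shiftOp_apply (N : ℕ) [NeZero N] (x : EuclideanSpace ℝ (ZMod N)) (i : ZMod N) :
    shiftOp N x i = x (i + 1) := by
  simp [shiftOp, LinearIsometryEquiv.piLpCongrLeft_apply, Equiv.piCongrLeft']

lemma shiftOp_symm_apply (N : ℕ) [NeZero N] (x : EuclideanSpace ℝ (ZMod N)) (i : ZMod N) :
    (shiftOp N).symm x i = x (i - 1) := by
  have := shiftOp_apply N ((shiftOp N).symm x) (i - 1)
  rw [LinearIsometryEquiv.apply_symm_apply] at this
  rw [this]; simp

noncomputable def bigOp {N : ℕ} [NeZero N] (W : ZMod N → ℝ) :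
    EuclideanSpace ℝ (ZMod N) →ₗ[ℝ] EuclideanSpace ℝ (ZMod N) :=
  (shiftOp N).toLinearEquiv.toLinearMap + (shiftOp N).symm.toLinearEquiv.toLinearMap + diagOp W

lemma bigOp_apply {N : ℕ} [NeZero N] (W : ZMod N → ℝ) (x : EuclideanSpace ℝ (ZMod N)) :
    bigOp W x = shiftOp N x + (shiftOp N).symm x + diagOp W x := rfl

lemma bigOp_symm {N : ℕ} [NeZero N] (W : ZMod N → ℝ) : (bigOp W).IsSymmetric := by
  intro x y
  rw [bigOp_apply, bigOp_apply]
  simp only [inner_add_left, inner_add_right]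
  have h1 : inner ℝ (shiftOp N x) y = inner ℝ x ((shiftOp N).symm y) := by
    rw [← (shiftOp N).inner_map_map x, LinearIsometryEquiv.apply_symm_apply]
  have h2 : inner ℝ ((shiftOp N).symm x) y = inner ℝ x (shiftOp N y) := by
    rw [← (shiftOp N).inner_map_map _ y, LinearIsometryEquiv.apply_symm_apply]
  have h3 : inner ℝ (diagOp W x) y = inner ℝ x (diagOp W y) := by
    simp only [PiLp.inner_apply, diagOp]
    apply Finset.sum_congr rfl
    intro i _
    simp; ring
  rw [h1, h2, h3]; ring

/-- Approximate periodic eigenfunction gives a nearby point of the spectrum. -/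
lemma near_spec (V : ℤ → ℝ) (q : ℕ) (hq : 1 ≤ q) (hV : ∀ n : ℤ, V (n + q) = V n) (E ρ : ℝ)
    (hρ : 1 ≤ ρ) (f : ℕ → ℝ) (hf : ∀ n, f (n + 2 * q) = f n)
    (hrec : ∀ n : ℕ, ρ * f (n + 2) + ρ⁻¹ * f n + V (n + 1) * f (n + 1) = E * f (n + 1))
    (hne : ∃ n, f n ≠ 0) : ∃ μ ∈ specV V q, |μ - E| ≤ ρ - ρ⁻¹ := by
  obtain ⟨N, hN⟩ : ∃ N, N = 2 * q := ⟨_, rfl⟩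
  have : NeZero N := ⟨by omega⟩
  have hρ' : ρ⁻¹ ≤ 1 := inv_le_one_of_one_le₀ hρ
  let W : ZMod N → ℝ := fun x => V (x.val : ℤ)
  let φ : EuclideanSpace ℝ (ZMod N) := WithLp.toLp 2 (fun x => f x.val)
  have hVp : Function.Periodic (fun n : ℕ => V (n : ℤ)) N := by
    intro n
    show V ((n + N : ℕ) : ℤ) = V n
    have : ((n + N : ℕ) : ℤ) = (n : ℤ) + q + q := by subst hN; push_cast; ring
    rw [this, hV, hV]
  have hfp : Function.Periodic f N := by
    intro n; rw [hN]; exact hf n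
  have hW : ∀ n : ℕ, W (n : ZMod N) = V n := by
    intro n
    show V (((n : ZMod N).val : ℕ) : ℤ) = V n
    rw [ZMod.val_natCast]
    exact hVp.map_mod_nat n
  have hφ : ∀ n : ℕ, φ (n : ZMod N) = f n := by
    intro n
    show f ((n : ZMod N).val) = f n
    rw [ZMod.val_natCast]
    exact hfp.map_mod_nat n
  have hφ0 : φ ≠ 0 := by
    obtain ⟨n, hn⟩ := hne
    intro h
    apply hn
    rw [← hφ, h]; simp
  have heq : bigOp W φ - E • φ = (1 - ρ) • shiftOp N φ + (1 - ρ⁻¹) • (shiftOp N).symm φ := by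
    ext i
    obtain ⟨n, rfl⟩ : ∃ n : ℕ, i = ((n + 1 : ℕ) : ZMod N) := by
      refine ⟨(i - 1).val, ?_⟩
      push_cast
      rw [ZMod.natCast_zmod_val]; ring
    have hs : shiftOp N φ ((n + 1 : ℕ) : ZMod N) = f (n + 2) := by
      rw [shiftOp_apply, ← hφ (n + 2)]
      have e : (((n + 1 : ℕ) : ZMod N) + 1) = ((n + 2 : ℕ) : ZMod N) := by push_cast; ring
      rw [e]
    have ht : (shiftOp N).symm φ ((n + 1 : ℕ) : ZMod N) = f n := by
      rw [shiftOp_symm_apply, ← hφ n]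
      have e : (((n + 1 : ℕ) : ZMod N) - 1) = ((n : ℕ) : ZMod N) := by push_cast; ring
      rw [e]
    have hd : diagOp W φ ((n + 1 : ℕ) : ZMod N) = V (n + 1) * f (n + 1) := by
      show W ((n + 1 : ℕ) : ZMod N) * φ ((n + 1 : ℕ) : ZMod N) = _
      rw [hW, hφ]; push_cast; rfl
    rw [bigOp_apply]
    simp only [PiLp.sub_apply, PiLp.add_apply, PiLp.smul_apply, smul_eq_mul, hs, ht, hd, hφ]
    linear_combination hrec n
  have hnorm : ‖bigOp W φ - E • φ‖ ≤ (ρ - ρ⁻¹) * ‖φ‖ := by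
    rw [heq]
    refine (norm_add_le _ _).trans ?_
    rw [norm_smul, norm_smul, LinearIsometryEquiv.norm_map, LinearIsometryEquiv.norm_map,
      Real.norm_eq_abs, Real.norm_eq_abs, abs_of_nonpos (by linarith : 1 - ρ ≤ 0),
      abs_of_nonneg (by linarith : 0 ≤ 1 - ρ⁻¹)]
    apply le_of_eq; ring
  obtain ⟨μ, hμ, g, hg0, hg⟩ := approx_eig (bigOp W) (bigOp_symm W) E (ρ - ρ⁻¹) (by linarith)
    φ hφ0 hnorm
  refine ⟨μ, ?_, hμ⟩
  apply mem_spec V q hV μ (fun n => g (n : ZMod N))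
  · intro n
    show g ((n + 2 * q : ℕ) : ZMod N) = g n
    rw [← hN]; simp
  · intro n
    have := congrArg (fun x : EuclideanSpace ℝ (ZMod N) => x ((n + 1 : ℕ) : ZMod N)) hg
    simp only [bigOp_apply, PiLp.add_apply, PiLp.smul_apply, smul_eq_mul, shiftOp_apply,
      shiftOp_symm_apply] at this
    have hd : diagOp W g ((n + 1 : ℕ) : ZMod N) = V (n + 1) * g ((n + 1 : ℕ) : ZMod N) := by
      show W ((n + 1 : ℕ) : ZMod N) * g ((n + 1 : ℕ) : ZMod N) = _
      rw [hW]; push_cast; rfl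
    rw [hd] at this
    have e1 : (((n + 1 : ℕ) : ZMod N) + 1) = ((n + 2 : ℕ) : ZMod N) := by push_cast; ring
    have e2 : (((n + 1 : ℕ) : ZMod N) - 1) = ((n : ℕ) : ZMod N) := by push_cast; ring
    rw [e1, e2] at this
    exact this
  · by_contra hall
    push Not at hall
    apply hg0
    ext i
    have := hall i.val
    rwa [ZMod.natCast_zmod_val] at this

lemma exists_root (t : ℝ) (ht : 2 < |t|) :
    ∃ l : ℝ, l ^ 2 - l * t + 1 = 0 ∧ 1 ≤ |l| ∧ |l| ≤ |t| := by
  have h4 : 0 ≤ t ^ 2 - 4 := by nlinarith [sq_abs t]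
  have hs := Real.sq_sqrt h4
  have hs0 := Real.sqrt_nonneg (t ^ 2 - 4)
  have hst : √(t ^ 2 - 4) ≤ |t| := by
    rw [← Real.sqrt_sq_eq_abs]; exact Real.sqrt_le_sqrt (by linarith)
  set s := √(t ^ 2 - 4)
  rcases le_total 0 t with h | h
  · rw [abs_of_nonneg h] at *
    refine ⟨(t + s) / 2, by linear_combination hs / 4, ?_, ?_⟩
    · rw [abs_of_nonneg (by linarith)]; linarith
    · rw [abs_of_nonneg (by linarith)]; linarith
  · rw [abs_of_nonpos h] at *
    refine ⟨(t - s) / 2, by linear_combination hs / 4, ?_, ?_⟩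
    · rw [abs_of_nonpos (by linarith)]; linarith
    · rw [abs_of_nonpos (by linarith)]; linarith

/-- There is a universal constant `c > 0` such that for every potential `V`
periodic of period `q ≥ 1` and every `E₀` outside the essential spectrum `S`,
`|Δ(E₀)| ≥ exp[c·q·min(dist(E₀,S),1)]`. -/
theorem exp_dist_le_abs_discriminant :
    ∃ c : ℝ, 0 < c ∧
      ∀ (V : ℤ → ℝ) (q : ℕ), 1 ≤ q → (∀ n : ℤ, V (n + q) = V n) →
        ∀ E₀ : ℝ, E₀ ∉ specV V q →
          Real.exp (c * q * min (Metric.infDist E₀ (specV V q)) 1) ≤ |discrV V q E₀| := by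
  refine ⟨1 / 3, by norm_num, ?_⟩
  intro V q hq hV E hE
  have ht : 2 < |(cocycleV V E q).trace| := not_le.mp hE
  obtain ⟨l, hl, hl1, hlt⟩ := exists_root _ ht
  have hl0 : 0 < |l| := by linarith
  have hq0 : (0 : ℝ) < q := by exact_mod_cast hq
  set k : ℝ := Real.log |l| / q with hk
  have hk0 : 0 ≤ k := div_nonneg (Real.log_nonneg hl1) hq0.le
  have hlk : |l| = Real.exp (q * k) := by
    rw [hk, mul_div_cancel₀ _ hq0.ne', Real.exp_log hl0]
  set ρ : ℝ := Real.exp k with hρ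
  have hρpos : 0 < ρ := Real.exp_pos k
  have hρ1 : 1 ≤ ρ := Real.one_le_exp hk0
  have hρq : ρ ^ q = |l| := by rw [hlk, hρ, ← Real.exp_nat_mul]
  have hdet := det_sub_smul _ (cocycleV_det V E q) l
  rw [hl] at hdet
  obtain ⟨v, hv0, hv⟩ := Matrix.exists_mulVec_eq_zero_iff.mpr hdet
  have hv' : cocycleV V E q *ᵥ v = l • v := by
    rw [Matrix.sub_mulVec, Matrix.smul_mulVec, Matrix.one_mulVec] at hv
    exact sub_eq_zero.mp hv
  let ψ : ℕ → ℝ := fun n => (cocycleV V E n *ᵥ v) 1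
  have hψq : ∀ n, ψ (n + q) = l * ψ n := by
    intro n
    simp only [ψ]
    rw [cocycleV_add V q hV, ← Matrix.mulVec_mulVec, hv', Matrix.mulVec_smul]
    simp
  have hψ1 : ∀ n, ψ (n + 1) = (cocycleV V E n *ᵥ v) 0 := by
    intro n
    simp only [ψ]
    rw [cocycleV, ← Matrix.mulVec_mulVec]
    simp [transferV, Matrix.mulVec, dotProduct, Fin.sum_univ_two]
  have hψ2 : ∀ n : ℕ, ψ (n + 2) = (E - V (n + 1)) * ψ (n + 1) - ψ n := by
    intro n
    rw [hψ1 (n + 1), hψ1 n, cocycleV, ← Matrix.mulVec_mulVec]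
    simp only [ψ]
    generalize cocycleV V E n *ᵥ v = w
    simp [transferV, Matrix.mulVec, dotProduct, Fin.sum_univ_two]
    ring
  have hne : ∃ n, ψ n ≠ 0 := by
    by_contra hall
    push Not at hall
    apply hv0
    have a := hall 0
    have b := hall 1
    rw [hψ1 0] at b
    simp only [ψ, cocycleV, Matrix.one_mulVec] at a b
    ext i
    fin_cases i
    · exact b
    · exact a
  obtain ⟨μ, hμ, hμE⟩ := near_spec V q hq hV E ρ hρ1 (fun n => ψ n / ρ ^ n)
    (by
      intro n
      show ψ (n + 2 * q) / ρ ^ (n + 2 * q) = ψ n / ρ ^ n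
      have e : n + 2 * q = n + q + q := by ring
      rw [e, hψq, hψq, pow_add, pow_add, hρq, mul_assoc, abs_mul_abs_self]
      have : l ≠ 0 := abs_pos.mp hl0
      field_simp)
    (by
      intro n
      show ρ * (ψ (n + 2) / ρ ^ (n + 2)) + ρ⁻¹ * (ψ n / ρ ^ n)
        + V (n + 1) * (ψ (n + 1) / ρ ^ (n + 1)) = E * (ψ (n + 1) / ρ ^ (n + 1))
      rw [hψ2, pow_add, pow_add]
      field_simp
      ring)
    (by
      obtain ⟨n, hn⟩ := hne
      exact ⟨n, div_ne_zero hn (by positivity)⟩)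
  have hd : Metric.infDist E (specV V q) ≤ ρ - ρ⁻¹ := by
    refine (Metric.infDist_le_dist_of_mem hμ).trans ?_
    rw [dist_comm, Real.dist_eq]; exact hμE
  have hmin : min (Metric.infDist E (specV V q)) 1 ≤ 3 * k := by
    rcases le_total 1 (3 * k) with h | h
    · exact (min_le_right _ _).trans h
    · refine (min_le_left _ _).trans (hd.trans ?_)
      have h1 : ρ - 1 ≤ 2 * k := by
        have := Real.abs_exp_sub_one_le (x := k) (by rw [abs_of_nonneg hk0]; linarith)
        rw [abs_of_nonneg hk0] at this
        exact (le_abs_self _).trans this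
      have h2 : 1 - k ≤ ρ⁻¹ := by
        rw [hρ, ← Real.exp_neg]
        have := Real.add_one_le_exp (-k); linarith
      linarith
  calc Real.exp (1 / 3 * q * min (Metric.infDist E (specV V q)) 1)
      ≤ Real.exp (q * k) := by
        apply Real.exp_le_exp.mpr
        have := mul_le_mul_of_nonneg_left hmin hq0.le
        nlinarith
    _ = |l| := hlk.symm
    _ ≤ _ := hlt
end

section
/- In the trigonometric case f = P with P(θ) = Σ_{k=−d}^{d} a_k e^{ikθ}, for every α ∈ ℝ, every E ∈ ℝ, and every n ≥ 1, the extreme Fourier coefficients of the n-step discriminant are C_{dn,n}(E,α) = (−a_d)^n · exp[iπα d n(n+1)] and C_{−dn,n}(E,α) = (−a_{−d})^n · exp[−iπα d n(n+1)]. -/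
open MeasureTheory Filter Matrix

attribute [local instance] Matrix.normedAddCommGroup

noncomputable def transfer (f : ℝ → ℝ) (E α θ : ℝ) (n : ℕ) : Matrix (Fin 2) (Fin 2) ℝ :=
  !![E - f (2 * Real.pi * α * n + θ), -1; 1, 0]

noncomputable def cocycle (f : ℝ → ℝ) (E α θ : ℝ) : ℕ → Matrix (Fin 2) (Fin 2) ℝ
  | 0 => 1
  | n + 1 => transfer f E α θ (n + 1) * cocycle f E α θ n

noncomputable def disc (f : ℝ → ℝ) (n : ℕ) (E α θ : ℝ) : ℝ :=
  (cocycle f E α θ n).trace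

noncomputable def avgLyap (f : ℝ → ℝ) (E α : ℝ) : ℝ :=
  Filter.limsup (fun n : ℕ =>
    (1 / (2 * Real.pi * n)) * ∫ θ in (0:ℝ)..(2 * Real.pi),
      Real.log ‖cocycle f E α θ n‖) Filter.atTop

def periodicSpectrum (f : ℝ → ℝ) (p : ℤ) (q : ℕ) (θ : ℝ) : Set ℝ :=
  {E : ℝ | |disc f q E ((p : ℝ) / q) θ| ≤ 2}

def SMinus (f : ℝ → ℝ) (p : ℤ) (q : ℕ) : Set ℝ :=
  ⋂ θ ∈ Set.Ico (0:ℝ) (2 * Real.pi), periodicSpectrum f p q θ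

noncomputable def fourierCoef (f : ℝ → ℝ) (k : ℤ) (n : ℕ) (E α : ℝ) : ℂ :=
  (1 / (2 * Real.pi)) * ∫ θ in (0:ℝ)..(2 * Real.pi),
    (disc f n E α θ : ℂ) * Complex.exp (-Complex.I * k * θ)

noncomputable def discTrunc (f : ℝ → ℝ) (n m : ℕ) (E α θ : ℝ) : ℂ :=
  ∑ k ∈ Finset.Icc (-(m : ℤ)) (m : ℤ),
    fourierCoef f k n E α * Complex.exp (Complex.I * k * θ)

noncomputable def Mmax (f : ℝ → ℝ) (n : ℕ) (E α : ℝ) : ℝ :=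
  sSup ((fun θ => |disc f n E α θ|) '' Set.Ico 0 (2 * Real.pi))

noncomputable def specRad (A : Matrix (Fin 2) (Fin 2) ℝ) : ℝ :=
  (spectralRadius ℂ (A.map (Complex.ofReal ·))).toReal

noncomputable def eMode (k : ℤ) : ℝ → ℂ := fun θ => Complex.exp (Complex.I * k * θ)

noncomputable def lowModes (N : ℤ) : Submodule ℂ (ℝ → ℂ) := Submodule.span ℂ (eMode '' Set.Iic N)

lemma eMode_mul (j k : ℤ) : eMode j * eMode k = eMode (j + k) := by
  funext θ
  simp only [eMode, Pi.mul_apply, ← Complex.exp_add]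
  congr 1
  push_cast
  ring

lemma eMode_mem {k N : ℤ} (h : k ≤ N) : eMode k ∈ lowModes N :=
  Submodule.subset_span ⟨k, h, rfl⟩

lemma lowModes_mono {M N : ℤ} (h : M ≤ N) : lowModes M ≤ lowModes N :=
  Submodule.span_mono (Set.image_mono (Set.Iic_subset_Iic.2 h))

lemma mul_mem_lowModes {M N K : ℤ} (h : M + N ≤ K) {g k : ℝ → ℂ} (hg : g ∈ lowModes M)
    (hk : k ∈ lowModes N) : g * k ∈ lowModes K := by
  have h1 : lowModes M * lowModes N ≤ lowModes K := by
    unfold lowModes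
    rw [Submodule.span_mul_span]
    apply Submodule.span_mono
    rintro _ ⟨_, ⟨x, hx, rfl⟩, _, ⟨y, hy, rfl⟩, rfl⟩
    refine ⟨x + y, ?_, (eMode_mul x y).symm⟩
    simp only [Set.mem_Iic] at *
    omega
  exact h1 (Submodule.mul_mem_mul hg hk)

lemma integral_eMode (k : ℤ) (hk : k ≠ 0) :
    ∫ θ in (0:ℝ)..(2 * Real.pi), eMode k θ = 0 := by
  have hc : Complex.I * (k : ℂ) ≠ 0 := mul_ne_zero Complex.I_ne_zero (by exact_mod_cast hk)
  simp only [eMode]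
  rw [integral_exp_mul_complex hc]
  have : Complex.exp (Complex.I * k * ((2 * Real.pi : ℝ) : ℂ)) = 1 := by
    rw [Complex.exp_eq_one_iff]
    exact ⟨k, by push_cast; ring⟩
  rw [this]
  simp

lemma eMode_continuous (k : ℤ) : Continuous (eMode k) := by
  unfold eMode
  fun_prop

lemma lowModes_integral {N k : ℤ} (h : N < k) {g : ℝ → ℂ} (hg : g ∈ lowModes N) :
    Continuous g ∧ ∫ θ in (0:ℝ)..(2 * Real.pi), g θ * eMode (-k) θ = 0 := by
  unfold lowModes at hg
  induction hg using Submodule.span_induction with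
  | mem x hx =>
    obtain ⟨j, hj, rfl⟩ := hx
    refine ⟨eMode_continuous j, ?_⟩
    have : ∀ θ, eMode j θ * eMode (-k) θ = eMode (j + -k) θ := fun θ => by
      rw [← eMode_mul]; rfl
    simp only [this]
    apply integral_eMode
    simp only [Set.mem_Iic] at hj
    omega
  | zero => exact ⟨continuous_const, by simp⟩
  | add x y _ _ hx hy =>
    refine ⟨hx.1.add hy.1, ?_⟩
    simp only [Pi.add_apply, add_mul]
    rw [intervalIntegral.integral_add, hx.2, hy.2, add_zero]
    · exact (hx.1.mul (eMode_continuous _)).intervalIntegrable _ _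
    · exact (hy.1.mul (eMode_continuous _)).intervalIntegrable _ _
  | smul c x _ hx =>
    refine ⟨hx.1.const_smul c, ?_⟩
    simp only [Pi.smul_apply, smul_eq_mul, mul_assoc]
    rw [intervalIntegral.integral_const_mul, hx.2, mul_zero]

/-- Top coefficient of `E - f` shifted. -/
lemma step_top (d : ℕ) (hd : 1 ≤ d) (a : ℤ → ℂ) (f : ℝ → ℝ)
    (hf : ∀ θ : ℝ, (f θ : ℂ) =
      ∑ k ∈ Finset.Icc (-(d : ℤ)) (d : ℤ), a k * Complex.exp (Complex.I * k * θ))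
    (E x : ℝ) :
    (fun θ : ℝ => ((E - f (x + θ) : ℝ) : ℂ)) -
      (-(a d) * Complex.exp (Complex.I * d * x)) • eMode d ∈ lowModes (d - 1) := by
  have key : (fun θ : ℝ => ((E - f (x + θ) : ℝ) : ℂ)) -
      (-(a d) * Complex.exp (Complex.I * d * x)) • eMode d =
      (E : ℂ) • eMode 0 - ∑ k ∈ (Finset.Icc (-(d : ℤ)) (d : ℤ)).erase d,
        (a k * Complex.exp (Complex.I * k * x)) • eMode k := by
    have h2 : ∀ (k : ℤ) (θ : ℝ), a k * Complex.exp (Complex.I * k * ((x + θ : ℝ) : ℂ)) =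
        (a k * Complex.exp (Complex.I * k * x)) * eMode k θ := by
      intro k θ
      rw [eMode, mul_assoc (a k), ← Complex.exp_add]
      congr 2
      push_cast
      ring
    funext θ
    have h3 := hf (x + θ)
    simp only [h2] at h3
    rw [← Finset.add_sum_erase _ _ (show (d : ℤ) ∈ Finset.Icc (-(d : ℤ)) (d : ℤ) by simp)] at h3
    simp only [Pi.sub_apply, Pi.smul_apply, Finset.sum_apply, smul_eq_mul]
    push_cast at h3 ⊢
    rw [h3]
    have : eMode 0 θ = 1 := by simp [eMode]
    rw [this]
    ring
  rw [key]
  refine Submodule.sub_mem _ (Submodule.smul_mem _ _ (eMode_mem (by omega))) ?_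
  refine Submodule.sum_mem _ fun k hk => Submodule.smul_mem _ _ (eMode_mem ?_)
  simp only [Finset.mem_erase, Finset.mem_Icc] at hk
  omega

noncomputable def entryFun (f : ℝ → ℝ) (E α : ℝ) (n : ℕ) (i j : Fin 2) : ℝ → ℂ :=
  fun θ => (cocycle f E α θ n i j : ℂ)

lemma mem_of_top {N : ℤ} {g : ℝ → ℂ} {c : ℂ} (h : g - c • eMode N ∈ lowModes (N - 1)) :
    g ∈ lowModes N := by
  have := Submodule.add_mem _ (lowModes_mono (show N - 1 ≤ N by omega) h)
    (Submodule.smul_mem _ c (eMode_mem (le_refl N)))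
  simpa using this

lemma mul_top {M N : ℤ} {g h : ℝ → ℂ} {b c : ℂ} (hg : g - b • eMode M ∈ lowModes (M - 1))
    (hh : h - c • eMode N ∈ lowModes (N - 1)) :
    g * h - (b * c) • eMode (M + N) ∈ lowModes (M + N - 1) := by
  have e : g * h - (b * c) • eMode (M + N) =
      (g - b • eMode M) * h + (b • eMode M) * (h - c • eMode N) := by
    rw [← eMode_mul]
    funext θ
    simp only [Pi.sub_apply, Pi.add_apply, Pi.mul_apply, Pi.smul_apply, smul_eq_mul]
    ring
  rw [e]
  exact Submodule.add_mem _ (mul_mem_lowModes (by omega) hg (mem_of_top hh))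
    (mul_mem_lowModes (by omega) (Submodule.smul_mem _ _ (eMode_mem le_rfl)) hh)

lemma entries_top (d : ℕ) (hd : 1 ≤ d) (a : ℤ → ℂ) (f : ℝ → ℝ)
    (hf : ∀ θ : ℝ, (f θ : ℂ) =
      ∑ k ∈ Finset.Icc (-(d : ℤ)) (d : ℤ), a k * Complex.exp (Complex.I * k * θ))
    (α E : ℝ) (n : ℕ) (hn : 1 ≤ n) :
    entryFun f E α n 0 0 - ((-(a d)) ^ n *
        Complex.exp (Complex.I * Real.pi * α * d * n * (n + 1))) • eMode ((d : ℤ) * n)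
        ∈ lowModes ((d : ℤ) * n - 1) ∧
      entryFun f E α n 0 1 ∈ lowModes ((d : ℤ) * n - 1) ∧
      entryFun f E α n 1 0 ∈ lowModes ((d : ℤ) * n - 1) ∧
      entryFun f E α n 1 1 ∈ lowModes ((d : ℤ) * n - 1) := by
  induction n, hn using Nat.le_induction with
  | base =>
    have h0 := step_top d hd a f hf E (2 * Real.pi * α * (1 : ℕ))
    have e00 : entryFun f E α 1 0 0 =
        fun θ : ℝ => ((E - f (2 * Real.pi * α * (1 : ℕ) + θ) : ℝ) : ℂ) := by
      funext θ
      simp [entryFun, cocycle, transfer]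
    have e01 : entryFun f E α 1 0 1 = (-1 : ℂ) • eMode 0 := by
      funext θ
      simp [entryFun, cocycle, transfer, eMode]
    have e10 : entryFun f E α 1 1 0 = eMode 0 := by
      funext θ
      simp [entryFun, cocycle, transfer, eMode]
    have e11 : entryFun f E α 1 1 1 = 0 := by
      funext θ
      simp [entryFun, cocycle, transfer]
    have hm : eMode 0 ∈ lowModes ((d : ℤ) * (1 : ℕ) - 1) := eMode_mem (by push_cast; omega)
    refine ⟨?_, ?_, ?_, ?_⟩
    · rw [e00]
      convert h0 using 3
      · simp
      · rw [pow_one]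
        congr 2
        push_cast
        ring
      · simp
    · rw [e01]; exact Submodule.smul_mem _ _ hm
    · rw [e10]; exact hm
    · rw [e11]; exact Submodule.zero_mem _
  | succ n hn ih =>
    obtain ⟨h00, h01, h10, h11⟩ := ih
    have h0 := step_top d hd a f hf E (2 * Real.pi * α * (n + 1 : ℕ))
    set S : ℝ → ℂ := fun θ : ℝ => ((E - f (2 * Real.pi * α * (n + 1 : ℕ) + θ) : ℝ) : ℂ) with hS
    have e0 : ∀ j, entryFun f E α (n + 1) 0 j =
        S * entryFun f E α n 0 j - entryFun f E α n 1 j := by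
      intro j
      funext θ
      simp [entryFun, cocycle, transfer, hS, Matrix.mul_apply, Fin.sum_univ_two, sub_eq_add_neg]
    have e1 : ∀ j, entryFun f E α (n + 1) 1 j = entryFun f E α n 0 j := by
      intro j
      funext θ
      simp [entryFun, cocycle, transfer, Matrix.mul_apply, Fin.sum_univ_two]
    have hN : (d : ℤ) * (n + 1 : ℕ) = d + d * n := by push_cast; ring
    rw [e0, e0, e1, e1, hN]
    refine ⟨?_, ?_, ?_, ?_⟩
    · have hm := mul_top h0 h00
      have hm2 := Submodule.sub_mem _ hm
        (lowModes_mono (show (d : ℤ) * n - 1 ≤ d + d * n - 1 by omega) h10)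
      convert hm2 using 1
      rw [sub_right_comm]
      congr 2
      congr 1
      rw [mul_mul_mul_comm, ← Complex.exp_add, ← pow_succ']
      congr 2
      push_cast
      ring
    · exact Submodule.sub_mem _ (mul_mem_lowModes (by omega) (mem_of_top h0) h01)
        (lowModes_mono (by omega) h11)
    · exact lowModes_mono (by omega) (mem_of_top h00)
    · exact lowModes_mono (by omega) h01

lemma fourierCoef_neg (f : ℝ → ℝ) (k : ℤ) (n : ℕ) (E α : ℝ) :
    fourierCoef f (-k) n E α = starRingEnd ℂ (fourierCoef f k n E α) := by
  unfold fourierCoef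
  rw [map_mul]
  congr 1
  · simp [Complex.conj_ofNat]
  · rw [intervalIntegral.integral_of_le (by positivity),
      intervalIntegral.integral_of_le (by positivity), ← integral_conj]
    congr 1
    funext θ
    rw [map_mul, ← Complex.exp_conj]
    simp

lemma top_fourierCoef (d : ℕ) (hd : 1 ≤ d) (a : ℤ → ℂ) (f : ℝ → ℝ)
    (hf : ∀ θ : ℝ, (f θ : ℂ) =
      ∑ k ∈ Finset.Icc (-(d : ℤ)) (d : ℤ), a k * Complex.exp (Complex.I * k * θ))
    (α E : ℝ) (n : ℕ) (hn : 1 ≤ n) :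
    fourierCoef f ((d : ℤ) * n) n E α =
        (-(a d)) ^ n * Complex.exp (Complex.I * Real.pi * α * d * n * (n + 1)) := by
  obtain ⟨h00, -, -, h11⟩ := entries_top d hd a f hf α E n hn
  set c := (-(a d)) ^ n * Complex.exp (Complex.I * Real.pi * α * d * n * (n + 1)) with hc
  have hg := Submodule.add_mem _ h00 h11
  obtain ⟨gc, gi⟩ := lowModes_integral (show (d : ℤ) * n - 1 < d * n by omega) hg
  set g := entryFun f E α n 0 0 - c • eMode ((d : ℤ) * n) + entryFun f E α n 1 1 with hgdef
  have key : ∀ θ : ℝ, (disc f n E α θ : ℂ) * Complex.exp (-Complex.I * ((d : ℤ) * n : ℤ) * θ) =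
      c + g θ * eMode (-((d : ℤ) * n)) θ := by
    intro θ
    have h1 : eMode ((d : ℤ) * n) θ * eMode (-((d : ℤ) * n)) θ = 1 := by
      have := congrFun (eMode_mul ((d : ℤ) * n) (-((d : ℤ) * n))) θ
      rw [Pi.mul_apply] at this
      rw [this]
      simp [eMode]
    have h2 : Complex.exp (-Complex.I * ((d : ℤ) * n : ℤ) * θ) = eMode (-((d : ℤ) * n)) θ := by
      rw [eMode]
      congr 1
      push_cast
      ring
    have h3 : (disc f n E α θ : ℂ) = entryFun f E α n 0 0 θ + entryFun f E α n 1 1 θ := by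
      simp [disc, entryFun, Matrix.trace_fin_two]
    rw [h2, h3, hgdef]
    simp only [Pi.sub_apply, Pi.add_apply, Pi.smul_apply, smul_eq_mul]
    linear_combination c * h1
  unfold fourierCoef
  simp only [key]
  have hint : IntervalIntegrable (fun θ => g θ * eMode (-((d : ℤ) * n)) θ) volume
      0 (2 * Real.pi) := (gc.mul (eMode_continuous _)).intervalIntegrable _ _
  rw [intervalIntegral.integral_add (by simp) hint, gi]
  have : (Real.pi : ℂ) ≠ 0 := by exact_mod_cast Real.pi_ne_zero
  simp
  field_simp

/-- In the trigonometric case `f = P` with `P(θ) = Σ_{k=−d}^d a_k e^{ikθ}`,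
for every `α`, `E`, and `n ≥ 1`, the extreme Fourier coefficients of the `n`-step discriminant
are `C_{±dn,n}(E,α) = (−a_{±d})^n exp[±iπαdn(n+1)]`. -/
theorem extreme_fourierCoef_eq
    (d : ℕ) (hd : 1 ≤ d) (a : ℤ → ℂ) (ha : ∀ k : ℤ, a (-k) = starRingEnd ℂ (a k))
    (f : ℝ → ℝ)
    (hf : ∀ θ : ℝ, (f θ : ℂ) =
      ∑ k ∈ Finset.Icc (-(d : ℤ)) (d : ℤ), a k * Complex.exp (Complex.I * k * θ))
    (α E : ℝ) (n : ℕ) (hn : 1 ≤ n) :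
    fourierCoef f ((d : ℤ) * n) n E α =
        (-(a d)) ^ n * Complex.exp (Complex.I * Real.pi * α * d * n * (n + 1)) ∧
      fourierCoef f (-((d : ℤ) * n)) n E α =
        (-(a (-(d : ℤ)))) ^ n * Complex.exp (-(Complex.I * Real.pi * α * d * n * (n + 1))) := by
  have h := top_fourierCoef d hd a f hf α E n hn
  refine ⟨h, ?_⟩
  rw [fourierCoef_neg, h, ha, map_mul, map_pow, map_neg, ← Complex.exp_conj]
  simp
end
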